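/- Let n ≥ 5 be an integer and let m be an integer. (1) If 4 ≤ m ≤ n − 1, then the minimum of γ_CR(G) over all finite simple graphs G of order n with m edges and CR(G) = 1 equals n − m + 1. (2) If n ≤ m ≤ C(n−1, 2), then this minimum equals 2. (3) If m > C(n−1, 2), then there is no finite simple graph G of order n with m edges and CR(G) = 1. -/

import Mathlib

open SimpleGraph Set

/-- The closed neighborhood `N[v]` of a vertex `v`. -/
def closedNbhd {V : Type*} (G : SimpleGraph V) (v : V) : Set V :=
  insert v (G.neighborSet v)

/-- `S` is a dominating set of `G`: every vertex lies in `N[s]` for some `s ∈ S`. -/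
def IsDomSet {V : Type*} (G : SimpleGraph V) (S : Set V) : Prop :=
  ∀ v : V, ∃ s ∈ S, v ∈ closedNbhd G s

/-- `CR(S)`: the number of vertices overdominated by `S`, i.e. with `|N[x] ∩ S| ≥ 2`. -/
noncomputable def crOf {V : Type*} (G : SimpleGraph V) (S : Set V) : ℕ :=
  {x : V | 2 ≤ (closedNbhd G x ∩ S).ncard}.ncard

/-- `CR(G)`: the minimum of `CR(S)` over all dominating sets `S` of `G`. -/
noncomputable def crNum {V : Type*} (G : SimpleGraph V) : ℕ :=
  sInf {k : ℕ | ∃ S : Set V, IsDomSet G S ∧ crOf G S = k}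

/-- `γ_CR(G)`: the minimum cardinality of a dominating set `S` with `CR(S) = CR(G)`. -/
noncomputable def gammaCR {V : Type*} (G : SimpleGraph V) : ℕ :=
  sInf {r : ℕ | ∃ S : Set V, IsDomSet G S ∧ crOf G S = crNum G ∧ S.ncard = r}

lemma two_le_ncard_closedNbhd_iff {V : Type*} [Finite V] (G : SimpleGraph V) (S : Set V) (v : V) :
    2 ≤ (closedNbhd G v ∩ S).ncard ↔
      ∃ s ∈ S, ∃ t ∈ S, s ≠ t ∧ v ∈ closedNbhd G s ∧ v ∈ closedNbhd G t := by
  have h : ∀ s, s ∈ closedNbhd G v ↔ v ∈ closedNbhd G s := fun s => by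
    simp [closedNbhd, G.adj_comm, eq_comm]
  rw [show 2 ≤ (closedNbhd G v ∩ S).ncard ↔ 1 < (closedNbhd G v ∩ S).ncard from Iff.rfl,
    Set.one_lt_ncard_iff (Set.toFinite _)]
  simp only [Set.mem_inter_iff, h]
  constructor
  · rintro ⟨s, t, ⟨hs, hsS⟩, ⟨ht, htS⟩, hst⟩
    exact ⟨s, hsS, t, htS, hst, hs, ht⟩
  · rintro ⟨s, hsS, t, htS, hst, hs, ht⟩
    exact ⟨s, t, ⟨hs, hsS⟩, ⟨ht, htS⟩, hst⟩

lemma mem_closedNbhd {V : Type*} (G : SimpleGraph V) (s v : V) :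
    v ∈ closedNbhd G s ↔ v = s ∨ G.Adj s v := by
  simp [closedNbhd]

/-- `S` dominates every vertex exactly once. -/
def IsEffDom {V : Type*} (G : SimpleGraph V) (S : Set V) : Prop :=
  IsDomSet G S ∧
    ∀ v, ∀ s ∈ S, ∀ t ∈ S, v ∈ closedNbhd G s → v ∈ closedNbhd G t → s = t

/-- `S` dominates every vertex, and `x` is the only vertex dominated more than once. -/
def IsNearEffDom {V : Type*} (G : SimpleGraph V) (S : Set V) (x : V) : Prop :=
  IsDomSet G S ∧
    (∃ s ∈ S, ∃ t ∈ S, s ≠ t ∧ x ∈ closedNbhd G s ∧ x ∈ closedNbhd G t) ∧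
    ∀ v, v ≠ x → ∀ s ∈ S, ∀ t ∈ S, v ∈ closedNbhd G s → v ∈ closedNbhd G t → s = t

lemma isEffDom_iff {V : Type*} [Finite V] (G : SimpleGraph V) (S : Set V) :
    IsEffDom G S ↔ IsDomSet G S ∧ crOf G S = 0 := by
  unfold IsEffDom crOf
  rw [Set.ncard_eq_zero (Set.toFinite _), Set.eq_empty_iff_forall_notMem]
  simp only [Set.mem_ofPred_eq, two_le_ncard_closedNbhd_iff]
  grind

lemma exists_isNearEffDom_iff {V : Type*} [Finite V] (G : SimpleGraph V) (S : Set V) :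
    (∃ x, IsNearEffDom G S x) ↔ IsDomSet G S ∧ crOf G S = 1 := by
  unfold IsNearEffDom crOf
  rw [Set.ncard_eq_one]
  simp only [Set.ext_iff, Set.mem_ofPred_eq, Set.mem_singleton_iff, two_le_ncard_closedNbhd_iff]
  constructor
  · rintro ⟨x, hd, hx, hu⟩
    refine ⟨hd, x, fun v => ⟨?_, ?_⟩⟩
    · rintro ⟨s, hs, t, ht, hst, h1, h2⟩
      by_contra hv
      exact hst (hu v hv s hs t ht h1 h2)
    · rintro rfl
      exact hx
  · rintro ⟨hd, x, hx⟩
    refine ⟨x, hd, (hx x).2 rfl, fun v hv s hs t ht h1 h2 => ?_⟩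
    by_contra hst
    exact hv ((hx v).1 ⟨s, hs, t, ht, hst, h1, h2⟩)

lemma isDomSet_univ {V : Type*} (G : SimpleGraph V) : IsDomSet G Set.univ :=
  fun v => ⟨v, Set.mem_univ v, by simp [closedNbhd]⟩

lemma crNum_eq_one_iff {V : Type*} [Finite V] (G : SimpleGraph V) :
    crNum G = 1 ↔ (∀ S, ¬ IsEffDom G S) ∧ ∃ S x, IsNearEffDom G S x := by
  simp only [exists_isNearEffDom_iff, isEffDom_iff]
  have hne : {k : ℕ | ∃ S : Set V, IsDomSet G S ∧ crOf G S = k}.Nonempty :=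
    ⟨_, Set.univ, isDomSet_univ G, rfl⟩
  constructor
  · intro h
    refine ⟨fun S hS => ?_, ?_⟩
    · have : crNum G ≤ 0 := Nat.sInf_le ⟨S, hS⟩
      omega
    · have := Nat.sInf_mem hne
      rw [show sInf _ = 1 from h] at this
      exact this
  · rintro ⟨h0, S, hS⟩
    have h1 : crNum G ≤ 1 := Nat.sInf_le ⟨S, hS⟩
    have h2 : crNum G ≠ 0 := by
      intro h
      have := Nat.sInf_mem hne
      rw [show sInf _ = 0 from h] at this
      obtain ⟨S, hS⟩ := this
      exact h0 S hS
    omega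

lemma exists_ncard_eq_gammaCR {V : Type*} [Finite V] {G : SimpleGraph V} (h : crNum G = 1) :
    ∃ S x, IsNearEffDom G S x ∧ S.ncard = gammaCR G := by
  obtain ⟨S, x, hS⟩ := ((crNum_eq_one_iff G).1 h).2
  obtain ⟨hS1, hS2⟩ := (exists_isNearEffDom_iff G S).1 ⟨x, hS⟩
  obtain ⟨T, hT1, hT2, hT3⟩ := Nat.sInf_mem
    (s := {r : ℕ | ∃ S : Set V, IsDomSet G S ∧ crOf G S = crNum G ∧ S.ncard = r})
    ⟨_, S, hS1, hS2.trans h.symm, rfl⟩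
  obtain ⟨y, hy⟩ := (exists_isNearEffDom_iff G T).2 ⟨hT1, hT2.trans h⟩
  exact ⟨T, y, hy, hT3⟩

lemma gammaCR_le {V : Type*} [Finite V] {G : SimpleGraph V} (h : crNum G = 1) {S : Set V} {x : V}
    (hS : IsNearEffDom G S x) : gammaCR G ≤ S.ncard := by
  obtain ⟨hS1, hS2⟩ := (exists_isNearEffDom_iff G S).1 ⟨x, hS⟩
  exact Nat.sInf_le ⟨S, hS1, hS2.trans h.symm, rfl⟩

lemma two_le_gammaCR {V : Type*} [Finite V] {G : SimpleGraph V} (h : crNum G = 1) :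
    2 ≤ gammaCR G := by
  obtain ⟨S, x, ⟨_, ⟨s, hs, t, ht, hst, _⟩, _⟩, hc⟩ := exists_ncard_eq_gammaCR h
  rw [← hc]
  exact (Set.one_lt_ncard_iff (Set.toFinite _)).2 ⟨s, t, hs, ht, hst⟩

/-- A dominating set overdominating only `x` forces an edge for every outside vertex, and one more
at `x`. -/
lemma IsNearEffDom.card_lt {V : Type*} [Fintype V] {G : SimpleGraph V} {S : Set V} {x : V}
    (hS : IsNearEffDom G S x) : Fintype.card V + 1 ≤ G.edgeSet.ncard + S.ncard := by
  obtain ⟨hd, ⟨s, hs, t, ht, hst, hxs, hxt⟩, hu⟩ := hS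
  have hxS : x ∉ S := by
    intro hx
    rw [mem_closedNbhd] at hxs hxt
    have key : ∀ w ∈ S, G.Adj w x → False := fun w hw hwx => by
      have := hu w hwx.ne w hw x hx (by simp [mem_closedNbhd])
        (by simp [mem_closedNbhd, hwx.symm])
      exact hwx.ne this
    rcases hxs with rfl | hxs
    · rcases hxt with rfl | hxt
      · exact hst rfl
      · exact key t ht hxt
    · exact key s hs hxs
  choose c hcS hc using hd
  have hcadj : ∀ v ∉ S, G.Adj (c v) v := fun v hv => by
    have := hc v
    rw [mem_closedNbhd] at this
    rcases this with h | h
    · exact absurd (h ▸ hcS v) hv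
    · exact h
  obtain ⟨b, hb, hbc, hbx⟩ : ∃ b ∈ S, b ≠ c x ∧ G.Adj b x := by
    rw [mem_closedNbhd] at hxs hxt
    by_cases h : s = c x
    · exact ⟨t, ht, fun h' => hst (h.trans h'.symm), hxt.resolve_left (by rintro rfl; exact hxS ht)⟩
    · exact ⟨s, hs, h, hxs.resolve_left (by rintro rfl; exact hxS hs)⟩
  have hinj : Set.InjOn (fun v => s(c v, v)) Sᶜ := by
    intro v hv w hw h
    have := hcS v
    have := hcS w
    simp only [Set.mem_compl_iff] at hv hw
    simp only [Sym2.eq_iff] at h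
    grind
  have hnot : s(b, x) ∉ (fun v => s(c v, v)) '' Sᶜ := by
    rintro ⟨v, hv, h⟩
    simp only [Set.mem_compl_iff] at hv
    simp only [Sym2.eq_iff] at h
    grind
  have hsub : insert s(b, x) ((fun v => s(c v, v)) '' Sᶜ) ⊆ G.edgeSet := by
    rintro e (rfl | ⟨v, hv, rfl⟩)
    · exact hbx
    · exact hcadj v hv
  have h1 := Set.ncard_le_ncard hsub (Set.toFinite _)
  rw [Set.ncard_insert_of_notMem hnot (Set.toFinite _), hinj.ncard_image] at h1
  have h2 := Set.ncard_add_ncard_compl S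
  rw [Nat.card_eq_fintype_card] at h2
  omega

lemma ncard_edgeSet_add_compl {V : Type*} [Fintype V] (G : SimpleGraph V) :
    G.edgeSet.ncard + Gᶜ.edgeSet.ncard = (Fintype.card V).choose 2 := by
  classical
  rw [← Set.ncard_union_eq _ (Set.toFinite _) (Set.toFinite _), ← edgeSet_sup, sup_compl_eq_top,
    ← coe_edgeFinset, Set.ncard_coe_finset, card_edgeFinset_top_eq_card_choose_two]
  rw [disjoint_edgeSet]
  exact disjoint_compl_right

lemma choose_two_pred (n : ℕ) (hn : 1 ≤ n) : n.choose 2 = (n - 1).choose 2 + (n - 1) := by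
  obtain ⟨k, rfl⟩ : ∃ k, n = k + 1 := ⟨n - 1, by omega⟩
  rw [Nat.choose_succ_succ' k 1, Nat.choose_one_right, Nat.add_sub_cancel, add_comm]

lemma card_le_ncard_compl_edgeSet {V : Type*} [Fintype V] {G : SimpleGraph V} (h : crNum G = 1) :
    Fintype.card V ≤ Gᶜ.edgeSet.ncard + 1 := by
  classical
  obtain ⟨h0, S, x, hd, ⟨a, ha, b, hb, hab, hxa, hxb⟩, hu⟩ := (crNum_eq_one_iff G).1 h
  obtain ⟨y, hxy, hy⟩ : ∃ y, x ≠ y ∧ ¬ G.Adj x y := by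
    by_contra! hx
    refine h0 {x} ⟨fun v => ⟨x, rfl, ?_⟩, ?_⟩
    · rw [mem_closedNbhd]
      by_cases hv : x = v
      · exact Or.inl hv.symm
      · exact Or.inr (hx v hv)
    · rintro v s rfl t rfl - -
      rfl
  have hcom : ∀ v, v ≠ x → G.Adj a v → G.Adj b v → False := fun v hv h1 h2 =>
    hab (hu v hv a ha b hb (by simp [mem_closedNbhd, h1]) (by simp [mem_closedNbhd, h2]))
  have hnadj : ¬ G.Adj a b := fun hadj => by
    have h1 : ∀ v, v = a ∨ v = b → v = x := fun v hv => by
      by_contra hvx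
      refine hab (hu v hvx a ha b hb ?_ ?_) <;> rw [mem_closedNbhd] <;>
        rcases hv with rfl | rfl <;> simp [hadj, hadj.symm]
    exact hab ((h1 a (Or.inl rfl)).trans (h1 b (Or.inr rfl)).symm)
  have hxa' : x ≠ a := by
    rintro rfl
    rw [mem_closedNbhd] at hxb
    rcases hxb with h | h
    · exact hab h
    · exact hnadj h.symm
  have hxb' : x ≠ b := by
    rintro rfl
    rw [mem_closedNbhd] at hxa
    rcases hxa with h | h
    · exact hab h.symm
    · exact hnadj h
  let f : V → V := fun v => if v = x then y else if v = a then b else if G.Adj a v then b else a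
  have hf : ∀ v ∈ ({b} : Set V)ᶜ, s(v, f v) ∈ Gᶜ.edgeSet := by
    intro v hv
    simp only [Set.mem_compl_iff, Set.mem_singleton_iff] at hv
    have h1 := hcom v
    rw [mem_edgeSet, compl_adj]
    simp only [f]
    have h2 := G.adj_comm v a
    have h3 := G.adj_comm v b
    split_ifs <;> grind
  have hinj : Set.InjOn (fun v => s(v, f v)) ({b} : Set V)ᶜ := by
    intro v hv w hw hvw
    simp only [Set.mem_compl_iff, Set.mem_singleton_iff] at hv hw
    simp only [Sym2.eq_iff, f] at hvw
    grind
  have hsub : (fun v => s(v, f v)) '' ({b} : Set V)ᶜ ⊆ Gᶜ.edgeSet := Set.image_subset_iff.2 hf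
  have h1 := Set.ncard_le_ncard hsub (Set.toFinite _)
  rw [hinj.ncard_image] at h1
  have h2 := Set.ncard_add_ncard_compl ({b} : Set V)
  rw [Nat.card_eq_fintype_card, Set.ncard_singleton] at h2
  omega

lemma exists_between_ncard_edgeSet {V : Type*} [Finite V] {G₁ G₂ : SimpleGraph V} (h : G₁ ≤ G₂)
    {m : ℕ} (h₁ : G₁.edgeSet.ncard ≤ m) (h₂ : m ≤ G₂.edgeSet.ncard) :
    ∃ G, G₁ ≤ G ∧ G ≤ G₂ ∧ G.edgeSet.ncard = m := by
  obtain ⟨E, hE1, hE2, hE⟩ := Set.exists_subsuperset_card_eq (edgeSet_subset_edgeSet.2 h) h₁ h₂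
  have hEE : (fromEdgeSet E).edgeSet = E := by
    rw [edgeSet_fromEdgeSet, sdiff_eq_left]
    exact Set.disjoint_of_subset_left hE2
      (Set.disjoint_left.2 fun e he hd => G₂.not_isDiag_of_mem_edgeSet he hd)
  refine ⟨fromEdgeSet E, ?_, ?_, by rw [hEE, hE]⟩ <;> rw [← edgeSet_subset_edgeSet, hEE] <;>
    assumption

lemma ncard_compl_add {V : Type*} [Fintype V] (S : Set V) :
    S.ncard + Sᶜ.ncard = Fintype.card V := by
  rw [Set.ncard_add_ncard_compl, Nat.card_eq_fintype_card]

/-- No efficient dominating set exists when `b` and `w` are leaves hanging from the adjacent vertices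
`x` and `a`, and some further neighbor of `a` has its closed neighborhood inside `N[a]`. -/
lemma not_isEffDom_of_leaves {V : Type*} {G : SimpleGraph V} {a b x w u : V}
    (hbw : b ≠ w) (hux : u ≠ x) (huw : u ≠ w) (hub : u ≠ b)
    (hax : G.Adj a x) (haw : G.Adj a w) (hau : G.Adj a u)
    (hb : ∀ v, G.Adj b v ↔ v = x) (hw : ∀ v, G.Adj w v ↔ v = a)
    (hu : ∀ v, G.Adj u v → v ≠ x → v = a ∨ G.Adj a v) (S : Set V) : ¬ IsEffDom G S := by
  rintro ⟨hd, he⟩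
  simp only [mem_closedNbhd, IsDomSet] at hd he
  have hsymm : ∀ p q, G.Adj p q → G.Adj q p := fun p q h => h.symm
  have hirr : ∀ p, ¬ G.Adj p p := fun p => G.irrefl
  obtain ⟨s, hs, hsb⟩ := hd b
  obtain ⟨t, ht, htw⟩ := hd w
  obtain ⟨r, hr, hru⟩ := hd u
  have h1 : s = b ∨ s = x := by grind
  have h2 : t = w ∨ t = a := by grind
  have ex := he x
  have ea := he a
  clear he
  rcases h1 with rfl | rfl <;> rcases h2 with rfl | rfl
  · have : r ≠ s := by grind
    grind
  · grind
  · grind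
  · grind

lemma isNearEffDom_pair_union {V : Type*} {G : SimpleGraph V} {a b x : V} {I : Set V}
    (hab : a ≠ b) (hnab : ¬ G.Adj a b) (hax : G.Adj a x) (hbx : G.Adj b x)
    (hcom : ∀ v, G.Adj a v → G.Adj b v → v = x)
    (hcov : ∀ v, v = a ∨ v = b ∨ G.Adj a v ∨ G.Adj b v ∨ v ∈ I)
    (hI : ∀ i ∈ I, ∀ v, ¬ G.Adj i v) : IsNearEffDom G ({a, b} ∪ I) x := by
  have hirr : ∀ p, ¬ G.Adj p p := fun p => G.irrefl
  have hsymm : ∀ p q, G.Adj p q → G.Adj q p := fun p q h => h.symm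
  simp only [IsNearEffDom, IsDomSet, mem_closedNbhd, Set.mem_union, Set.mem_insert_iff,
    Set.mem_singleton_iff]
  refine ⟨fun v => ?_, ⟨a, by simp, b, by simp, hab, Or.inr hax, Or.inr hbx⟩, ?_⟩
  · rcases hcov v with h | h | h | h | h
    · exact ⟨a, by simp, Or.inl h⟩
    · exact ⟨b, by simp, Or.inl h⟩
    · exact ⟨a, by simp, Or.inr h⟩
    · exact ⟨b, by simp, Or.inr h⟩
    · exact ⟨v, by simp [h], Or.inl rfl⟩
  · intro v hv s hs t ht h1 h2
    clear hcov
    grind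

/-- In the `5`-cycle `a x b z y`, suppose that `b` has degree two, that `x y` and `a z` are
not chords, and that `a` and `z` are joined to all remaining vertices. -/
lemma not_isEffDom_of_cycle {V : Type*} {G : SimpleGraph V} {a b x y z : V}
    (hab : a ≠ b) (hby : b ≠ y) (hxy : x ≠ y) (hxz : x ≠ z) (hyz : y ≠ z)
    (hnxy : ¬ G.Adj x y) (haz : a ≠ z) (hnaz : ¬ G.Adj a z)
    (hax : G.Adj a x) (hay : G.Adj a y) (hb : ∀ v, G.Adj b v ↔ v = x ∨ v = z)
    (ha : ∀ v, v ≠ a → v ≠ b → v ≠ z → G.Adj a v)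
    (hz : ∀ v, v ≠ a → v ≠ x → v ≠ z → G.Adj z v) (S : Set V) : ¬ IsEffDom G S := by
  rintro ⟨hd, he⟩
  simp only [mem_closedNbhd, IsDomSet] at hd he
  have hirr : ∀ p, ¬ G.Adj p p := fun p => G.irrefl
  have hbx := (hb x).2 (Or.inl rfl)
  have hbz := (hb z).2 (Or.inr rfl)
  have hay' : a ≠ y := hay.ne
  have hax' : a ≠ x := hax.ne
  have hzy : G.Adj z y := hz y hay'.symm hxy.symm hyz
  have hnby : ¬ G.Adj b y := fun h => ((hb y).1 h).elim hxy.symm hyz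
  have hnba : ¬ G.Adj b a := fun h => ((hb a).1 h).elim hax' haz
  obtain ⟨s, hs, hsb⟩ := hd b
  obtain ⟨t, ht, hty⟩ := hd y
  obtain ⟨r, hr, hra⟩ := hd a
  have h1 : s = b ∨ s = x ∨ s = z := by
    rcases hsb with h | h
    · exact Or.inl h.symm
    · exact Or.inr ((hb s).1 h.symm)
  have htb : t ≠ b := by grind
  have htx : t ≠ x := by grind
  have hrb : r ≠ b := by grind
  have hrz : r ≠ z := by
    rintro rfl
    exact hra.elim haz fun h => hnaz h.symm
  rcases h1 with rfl | rfl | rfl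
  · by_cases hta : t = a
    · subst hta
      exact hab (he x t ht s hs (Or.inr hax) (Or.inr hbx))
    · by_cases htz : t = z
      · subst htz
        exact htb (he t t ht s hs (Or.inl rfl) (Or.inr hbz))
      · exact htb (he z t ht s hs (Or.inr (hz t hta htx htz).symm) (Or.inr hbz))
  · by_cases hta : t = a
    · subst hta
      exact htx (he s t ht s hs (Or.inr hax) (Or.inl rfl))
    · by_cases htz : t = z
      · subst htz
        exact htx (he b t ht s hs (Or.inr hbz.symm) (Or.inr hbx.symm))
      · exact htx (he a t ht s hs (Or.inr (ha t hta htb htz).symm) (Or.inr hax.symm))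
  · by_cases hra' : r = a
    · subst hra'
      exact hrz (he y r hr s hs (Or.inr hay) (Or.inr hzy))
    · by_cases hrx : r = x
      · subst hrx
        exact hrz (he b r hr s hs (Or.inr hbx.symm) (Or.inr hbz.symm))
      · exact hrz (he s r hr s hs (Or.inr (hz r hra' hrx hrz).symm) (Or.inl rfl))

/-- `a` is joined to everything except `b` and `I`, and `b` is joined to `x`. -/
def broom {V : Type*} (a b x : V) (I : Set V) : SimpleGraph V :=
  fromRel fun u v => (u = a ∧ v ≠ b ∧ v ∉ I) ∨ (u = b ∧ v = x)

lemma ncard_edgeSet_broom_le {V : Type*} [Fintype V] {a b x : V} {I : Set V} (hab : a ≠ b)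
    (ha : a ∉ I) (hb : b ∉ I) :
    (broom a b x I).edgeSet.ncard + I.ncard + 1 ≤ Fintype.card V := by
  have hsub : (broom a b x I).edgeSet ⊆
      insert s(b, x) ((fun v => s(a, v)) '' ({a, b} ∪ I)ᶜ) := by
    intro e
    induction e with | _ u v =>
    simp only [mem_edgeSet, broom, fromRel_adj, Set.mem_insert_iff, Set.mem_image,
      Set.mem_compl_iff, Set.mem_union, Set.mem_singleton_iff]
    rintro ⟨huv, (⟨rfl, h⟩ | ⟨rfl, rfl⟩) | (⟨rfl, h⟩ | ⟨rfl, rfl⟩)⟩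
    · exact Or.inr ⟨v, by grind, rfl⟩
    · exact Or.inl rfl
    · exact Or.inr ⟨u, by grind, Sym2.eq_swap⟩
    · exact Or.inl Sym2.eq_swap
  have h1 := Set.ncard_le_ncard hsub (Set.toFinite _)
  have h2 := Set.ncard_insert_le s(b, x) ((fun v => s(a, v)) '' ({a, b} ∪ I)ᶜ)
  have h3 := Set.ncard_image_le (f := fun v => s(a, v)) (Set.toFinite ({a, b} ∪ I)ᶜ)
  have h4 := ncard_compl_add ({a, b} ∪ I)
  have h5 : ({a, b} ∪ I).ncard = 2 + I.ncard := by
    rw [Set.ncard_union_eq _ (Set.toFinite _) (Set.toFinite _), Set.ncard_pair hab]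
    rw [Set.disjoint_left]
    rintro v (rfl | rfl) <;> assumption
  omega

/-- The broom without isolated vertices, with `x` also joined to everything except `w`. -/
def fatBroom {V : Type*} (a b x w : V) : SimpleGraph V :=
  fromRel fun u v => (u = a ∧ v ≠ b) ∨ (u = x ∧ v ≠ w)

lemma le_ncard_edgeSet_fatBroom {V : Type*} [Fintype V] {a b x w : V} (hab : a ≠ b) (hax : a ≠ x)
    (haw : a ≠ w) (hxw : x ≠ w) :
    2 * Fintype.card V ≤ (fatBroom a b x w).edgeSet.ncard + 5 := by
  have hsub : (fun v => s(a, v)) '' ({a, b} : Set V)ᶜ ∪ (fun v => s(x, v)) '' ({a, x, w} : Set V)ᶜ ⊆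
      (fatBroom a b x w).edgeSet := by
    rintro e (⟨v, hv, rfl⟩ | ⟨v, hv, rfl⟩) <;>
      simp only [mem_edgeSet, fatBroom, fromRel_adj, Set.mem_compl_iff, Set.mem_insert_iff,
        Set.mem_singleton_iff] at hv ⊢ <;> grind
  have hinj : ∀ c : V, Function.Injective fun v => s(c, v) := fun c v w h => Sym2.congr_right.1 h
  have h1 := Set.ncard_le_ncard hsub (Set.toFinite _)
  rw [Set.ncard_union_eq _ (Set.toFinite _) (Set.toFinite _),
    Set.ncard_image_of_injective _ (hinj a), Set.ncard_image_of_injective _ (hinj x)] at h1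
  · have h2 := ncard_compl_add ({a, b} : Set V)
    have h3 := ncard_compl_add ({a, x, w} : Set V)
    rw [Set.ncard_pair hab] at h2
    rw [Set.ncard_eq_three.2 ⟨a, x, w, hax, haw, hxw, rfl⟩] at h3
    omega
  · rw [Set.disjoint_left]
    rintro e ⟨v, hv, rfl⟩ ⟨u, hu, h⟩
    simp only [Set.mem_compl_iff, Set.mem_insert_iff, Set.mem_singleton_iff, Sym2.eq_iff] at hu hv h
    grind

/-- The sparsest graph of the dense family: a `5`-cycle `a x b z y` in which `a` and `z` are joined
to all further vertices. -/
def cycleMin {V : Type*} (a b x z : V) : SimpleGraph V :=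
  fromRel fun u v => (u = a ∧ v ≠ b ∧ v ≠ z) ∨ (u = z ∧ v ≠ a ∧ v ≠ x) ∨ (u = b ∧ v = x)

/-- The complement of the densest graph of the dense family. -/
def cycleMaxCompl {V : Type*} (a b x y z : V) : SimpleGraph V :=
  fromRel fun u v => (u = a ∧ v = z) ∨ (u = x ∧ v = y) ∨ (u = b ∧ v ≠ x ∧ v ≠ z)

lemma ncard_edgeSet_cycleMin_le {V : Type*} [Fintype V] {a b x z : V} (hab : a ≠ b) (haz : a ≠ z)
    (hbz : b ≠ z) (hax : a ≠ x) (hxz : x ≠ z) :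
    (cycleMin a b x z).edgeSet.ncard + 5 ≤ 2 * Fintype.card V := by
  have hsub : (cycleMin a b x z).edgeSet ⊆ insert s(b, x)
      ((fun v => s(a, v)) '' ({a, b, z} : Set V)ᶜ ∪ (fun v => s(z, v)) '' ({a, x, z} : Set V)ᶜ) := by
    intro e
    induction e with | _ u v =>
    simp only [mem_edgeSet, cycleMin, fromRel_adj, Set.mem_insert_iff, Set.mem_image, Set.mem_union,
      Set.mem_compl_iff, Set.mem_singleton_iff]
    rintro ⟨huv, (⟨rfl, h⟩ | ⟨rfl, h⟩ | ⟨rfl, rfl⟩) | (⟨rfl, h⟩ | ⟨rfl, h⟩ | ⟨rfl, rfl⟩)⟩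
    · exact Or.inr (Or.inl ⟨v, by grind, rfl⟩)
    · exact Or.inr (Or.inr ⟨v, by grind, rfl⟩)
    · exact Or.inl rfl
    · exact Or.inr (Or.inl ⟨u, by grind, Sym2.eq_swap⟩)
    · exact Or.inr (Or.inr ⟨u, by grind, Sym2.eq_swap⟩)
    · exact Or.inl Sym2.eq_swap
  have h1 := Set.ncard_le_ncard hsub (Set.toFinite _)
  have h2 := Set.ncard_insert_le s(b, x)
    ((fun v => s(a, v)) '' ({a, b, z} : Set V)ᶜ ∪ (fun v => s(z, v)) '' ({a, x, z} : Set V)ᶜ)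
  have h3 := Set.ncard_union_le
    ((fun v => s(a, v)) '' ({a, b, z} : Set V)ᶜ) ((fun v => s(z, v)) '' ({a, x, z} : Set V)ᶜ)
  have h4 := Set.ncard_image_le (f := fun v => s(a, v)) (Set.toFinite ({a, b, z} : Set V)ᶜ)
  have h5 := Set.ncard_image_le (f := fun v => s(z, v)) (Set.toFinite ({a, x, z} : Set V)ᶜ)
  have h6 := ncard_compl_add ({a, b, z} : Set V)
  have h7 := ncard_compl_add ({a, x, z} : Set V)
  rw [Set.ncard_eq_three.2 ⟨a, b, z, hab, haz, hbz, rfl⟩] at h6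
  rw [Set.ncard_eq_three.2 ⟨a, x, z, hax, haz, hxz, rfl⟩] at h7
  omega

lemma ncard_edgeSet_cycleMaxCompl_lt {V : Type*} [Fintype V] {a b x y z : V} (hbx : b ≠ x)
    (hbz : b ≠ z) (hxz : x ≠ z) :
    (cycleMaxCompl a b x y z).edgeSet.ncard + 1 ≤ Fintype.card V := by
  have hsub : (cycleMaxCompl a b x y z).edgeSet ⊆ insert s(a, z) (insert s(x, y)
      ((fun v => s(b, v)) '' ({b, x, z} : Set V)ᶜ)) := by
    intro e
    induction e with | _ u v =>
    simp only [mem_edgeSet, cycleMaxCompl, fromRel_adj, Set.mem_insert_iff, Set.mem_image,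
      Set.mem_compl_iff, Set.mem_singleton_iff]
    rintro ⟨huv, (⟨rfl, rfl⟩ | ⟨rfl, rfl⟩ | ⟨rfl, h⟩) | (⟨rfl, rfl⟩ | ⟨rfl, rfl⟩ | ⟨rfl, h⟩)⟩
    · exact Or.inl rfl
    · exact Or.inr (Or.inl rfl)
    · exact Or.inr (Or.inr ⟨v, by grind, rfl⟩)
    · exact Or.inl Sym2.eq_swap
    · exact Or.inr (Or.inl Sym2.eq_swap)
    · exact Or.inr (Or.inr ⟨u, by grind, Sym2.eq_swap⟩)
  have h1 := Set.ncard_le_ncard hsub (Set.toFinite _)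
  have h2 := Set.ncard_insert_le s(a, z) (insert s(x, y)
      ((fun v => s(b, v)) '' ({b, x, z} : Set V)ᶜ))
  have h3 := Set.ncard_insert_le s(x, y) ((fun v => s(b, v)) '' ({b, x, z} : Set V)ᶜ)
  have h4 := Set.ncard_image_le (f := fun v => s(b, v)) (Set.toFinite ({b, x, z} : Set V)ᶜ)
  have h5 := ncard_compl_add ({b, x, z} : Set V)
  rw [Set.ncard_eq_three.2 ⟨b, x, z, hbx, hbz, hxz, rfl⟩] at h5
  omega

lemma exists_five_distinct {V : Type*} [Fintype V] (h : 5 ≤ Fintype.card V) :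
    ∃ a b x y z : V, a ≠ b ∧ a ≠ x ∧ a ≠ y ∧ a ≠ z ∧ b ≠ x ∧ b ≠ y ∧ b ≠ z ∧ x ≠ y ∧ x ≠ z ∧
      y ≠ z := by
  obtain ⟨f⟩ : Nonempty (Fin 5 ↪ V) :=
    Function.Embedding.nonempty_of_card_le (by simpa using h)
  refine ⟨f 0, f 1, f 2, f 3, f 4, ?_⟩
  simp [f.injective.eq_iff]

lemma exists_gammaCR_eq_of_le {V : Type*} [Fintype V] {m : ℕ} (hn : 5 ≤ Fintype.card V)
    (hm : 4 ≤ m) (hmn : m + 1 ≤ Fintype.card V) :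
    ∃ G : SimpleGraph V, G.edgeSet.ncard = m ∧ crNum G = 1 ∧
      gammaCR G + m = Fintype.card V + 1 := by
  obtain ⟨a, b, x, w, u, hab, hax, haw, hau, hbx, hbw, hbu, hxw, hxu, hwu⟩ :=
    exists_five_distinct hn
  obtain ⟨I, hI, hIc⟩ : ∃ I ⊆ ({a, b, x, w, u} : Set V)ᶜ, I.ncard = Fintype.card V - (m + 1) := by
    refine Set.exists_subset_card_eq ?_
    have h1 := ncard_compl_add ({a, b, x, w, u} : Set V)
    have h2 : ({a, b, x, w, u} : Set V).ncard ≤ 5 := by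
      classical
      have := Finset.card_le_five (a := a) (b := b) (c := x) (d := w) (e := u)
      rw [← Set.ncard_coe_finset] at this
      simpa using this
    omega
  have hI' : ∀ v ∈ I, v ≠ a ∧ v ≠ b ∧ v ≠ x ∧ v ≠ w ∧ v ≠ u := fun v hv => by
    simpa using hI hv
  have hadj : ∀ p q, (broom a b x I).Adj p q ↔ p ≠ q ∧
      (((p = a ∧ q ≠ b ∧ q ∉ I) ∨ (p = b ∧ q = x)) ∨
        ((q = a ∧ p ≠ b ∧ p ∉ I) ∨ (q = b ∧ p = x))) := fun p q => fromRel_adj _ _ _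
  have hnear : IsNearEffDom (broom a b x I) ({a, b} ∪ I) x := by
    apply isNearEffDom_pair_union hab <;> simp only [hadj] <;> grind
  have hone : crNum (broom a b x I) = 1 := by
    refine (crNum_eq_one_iff _).2 ⟨?_, _, _, hnear⟩
    apply not_isEffDom_of_leaves hbw hxu.symm hwu.symm hbu.symm (a := a) <;> simp only [hadj] <;>
      grind
  have h1 := ncard_edgeSet_broom_le (x := x) hab (fun h => (hI' a h).1 rfl)
    (fun h => (hI' b h).2.1 rfl)
  have h2 := hnear.card_lt
  have h3 : ({a, b} ∪ I).ncard ≤ 2 + I.ncard := by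
    refine (Set.ncard_union_le _ _).trans ?_
    rw [Set.ncard_pair hab]
  have h4 := gammaCR_le hone hnear
  obtain ⟨S, y, hS, hSc⟩ := exists_ncard_eq_gammaCR hone
  have h5 := hS.card_lt
  exact ⟨broom a b x I, by omega, hone, by omega⟩

lemma exists_gammaCR_eq_two {V : Type*} [Fintype V] {m : ℕ} (hn : 5 ≤ Fintype.card V)
    (hm : Fintype.card V ≤ m) (hmn : m ≤ (Fintype.card V - 1).choose 2) :
    ∃ G : SimpleGraph V, G.edgeSet.ncard = m ∧ crNum G = 1 ∧ gammaCR G = 2 := by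
  obtain ⟨a, b, x, w, u, hab, hax, haw, hau, hbx, hbw, hbu, hxw, hxu, hwu⟩ :=
    exists_five_distinct hn
  suffices ∃ G : SimpleGraph V, G.edgeSet.ncard = m ∧ (∀ S, ¬ IsEffDom G S) ∧
      IsNearEffDom G ({a, b} ∪ ∅) x by
    obtain ⟨G, hG, h0, h1⟩ := this
    have hone := (crNum_eq_one_iff G).2 ⟨h0, _, _, h1⟩
    have h2 := gammaCR_le hone h1
    rw [Set.union_empty, Set.ncard_pair hab] at h2
    exact ⟨G, hG, hone, le_antisymm h2 (two_le_gammaCR hone)⟩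
  by_cases hlow : m + 5 ≤ 2 * Fintype.card V
  · have h1 := ncard_edgeSet_broom_le (x := x) (I := ∅) hab (by simp) (by simp)
    have h2 := le_ncard_edgeSet_fatBroom hab hax haw hxw
    have hle : broom a b x ∅ ≤ fatBroom a b x w := by
      intro p q
      simp only [broom, fatBroom, fromRel_adj]
      grind
    obtain ⟨G, hG1, hG2, hG⟩ := exists_between_ncard_edgeSet (m := m) hle (by omega) (by omega)
    have h3 : ∀ p q, _ → _ := fun p q => @hG1 p q
    have h4 : ∀ p q, _ → _ := fun p q => @hG2 p q
    simp only [broom, fatBroom, fromRel_adj, Set.mem_empty_iff_false, not_false_eq_true,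
      and_true] at h3 h4
    have hsymm : ∀ p q, G.Adj p q → G.Adj q p := fun p q h => h.symm
    refine ⟨G, hG, not_isEffDom_of_leaves (a := a) (b := b) (x := x) (w := w) (u := u)
      hbw hxu.symm hwu.symm hbu.symm ?_ ?_ ?_ ?_ ?_ ?_,
      isNearEffDom_pair_union hab ?_ ?_ ?_ ?_ ?_ ?_⟩ <;> grind
  · have h1 := ncard_edgeSet_cycleMin_le hab hau hbu hax hxu
    have h2 := ncard_edgeSet_cycleMaxCompl_lt (a := a) (y := w) hbx hbu hxu
    have h3 := ncard_edgeSet_add_compl (cycleMaxCompl a b x w u)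
    rw [choose_two_pred _ (by omega)] at h3
    have hle : cycleMin a b x u ≤ (cycleMaxCompl a b x w u)ᶜ := by
      intro p q
      simp only [cycleMin, cycleMaxCompl, compl_adj, fromRel_adj]
      grind
    obtain ⟨G, hG1, hG2, hG⟩ := exists_between_ncard_edgeSet (m := m) hle (by omega) (by omega)
    have h3 : ∀ p q, _ → _ := fun p q => @hG1 p q
    have h4 : ∀ p q, _ → _ := fun p q => @hG2 p q
    simp only [cycleMin, cycleMaxCompl, compl_adj, fromRel_adj] at h3 h4
    have hsymm : ∀ p q, G.Adj p q → G.Adj q p := fun p q h => h.symm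
    refine ⟨G, hG, not_isEffDom_of_cycle (a := a) (b := b) (x := x) (y := w) (z := u)
      hab hbw hxw hxu hwu ?_ hau ?_ ?_ ?_ ?_ ?_ ?_,
      isNearEffDom_pair_union hab ?_ ?_ ?_ ?_ ?_ ?_⟩ <;> grind

theorem d_n_one_m (n m : ℕ) (hn : 5 ≤ n) :
    ((4 ≤ m ∧ m ≤ n - 1) →
      (∀ (V : Type) [Fintype V] (G : SimpleGraph V), Fintype.card V = n →
          G.edgeSet.ncard = m → crNum G = 1 → n - m + 1 ≤ gammaCR G) ∧
      (∃ G : SimpleGraph (Fin n), G.edgeSet.ncard = m ∧ crNum G = 1 ∧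
          gammaCR G = n - m + 1)) ∧
    ((n ≤ m ∧ m ≤ (n - 1).choose 2) →
      (∀ (V : Type) [Fintype V] (G : SimpleGraph V), Fintype.card V = n →
          G.edgeSet.ncard = m → crNum G = 1 → 2 ≤ gammaCR G) ∧
      (∃ G : SimpleGraph (Fin n), G.edgeSet.ncard = m ∧ crNum G = 1 ∧
          gammaCR G = 2)) ∧
    ((n - 1).choose 2 < m →
      ∀ (V : Type) [Fintype V] (G : SimpleGraph V), Fintype.card V = n →
        G.edgeSet.ncard = m → crNum G ≠ 1) := by
  refine ⟨fun hm => ⟨?_, ?_⟩, fun hm => ⟨?_, ?_⟩, ?_⟩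
  · intro V _ G hV hG hone
    obtain ⟨S, y, hS, hSc⟩ := exists_ncard_eq_gammaCR hone
    have := hS.card_lt
    omega
  · obtain ⟨G, h1, h2, h3⟩ := exists_gammaCR_eq_of_le (V := Fin n) (m := m)
      (by simpa using hn) hm.1 (by rw [Fintype.card_fin]; omega)
    rw [Fintype.card_fin] at h3
    exact ⟨G, h1, h2, by omega⟩
  · intro V _ G _ _ hone
    exact two_le_gammaCR hone
  · exact exists_gammaCR_eq_two (by simpa using hn) (by simpa using hm.1) (by simpa using hm.2)
  · intro hm V _ G hV hG hone
    have h1 := card_le_ncard_compl_edgeSet hone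
    have h2 := ncard_edgeSet_add_compl G
    rw [hV, choose_two_pred n (by omega)] at h2
    omega
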